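/- arXiv:1509.01456 — 6 statements merged into one kernel-verified Lean document; each statement's English description precedes it below -/
import Mathlib

section
/- Let u and v be fuzzy numbers and let α ∈ [0,1]. If the left derivative of v at v⁻(α) equals 0 (i.e., v'₋(v⁻(α)) = 0), then the left derivative of u∇v at (u∇v)⁻(α) equals 0, i.e., (u∇v)'₋((u∇v)⁻(α)) = 0. -/
open Set Filter Topology

/-- A fuzzy number: a function `ℝ → ℝ` taking values in `[0,1]`, whose `α`-cuts
(for `α ∈ (0,1]`) and whose `0`-cut (the closure of the support) are nonempty
compact intervals. -/
structure FuzzyNumber where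
  f : ℝ → ℝ
  mem_Icc : ∀ x, f x ∈ Set.Icc (0 : ℝ) 1
  cut_isIcc : ∀ α ∈ Set.Ioc (0 : ℝ) 1, ∃ a b : ℝ, a ≤ b ∧ {x | α ≤ f x} = Set.Icc a b
  supp_isIcc : ∃ a b : ℝ, a ≤ b ∧ closure {x | 0 < f x} = Set.Icc a b

namespace FuzzyNumber

/-- The `α`-cut of a fuzzy number; for `α = 0` it is the closure of the support. -/
noncomputable def cut (u : FuzzyNumber) (α : ℝ) : Set ℝ :=
  if α = 0 then closure {x | 0 < u.f x} else {x | α ≤ u.f x}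

/-- Left endpoint `u⁻(α)` of the `α`-cut. -/
noncomputable def lo (u : FuzzyNumber) (α : ℝ) : ℝ := sInf (u.cut α)

/-- Right endpoint `u⁺(α)` of the `α`-cut. -/
noncomputable def hi (u : FuzzyNumber) (α : ℝ) : ℝ := sSup (u.cut α)

/-- Left endpoint `u_s⁻(α)` of the strong `α`-cut: `lim_{β→α⁺} u⁻(β)` for `α < 1`,
and `u⁻(1)` for `α = 1`.  Since `u⁻` is nondecreasing, this right limit is the
infimum of `u⁻` over `(α,1]`. -/
noncomputable def slo (u : FuzzyNumber) (α : ℝ) : ℝ :=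
  if α < 1 then sInf (u.lo '' Set.Ioc α 1) else u.lo 1

/-- Right endpoint `u_s⁺(α)` of the strong `α`-cut: `lim_{β→α⁺} u⁺(β)` for `α < 1`,
and `u⁺(1)` for `α = 1`. -/
noncomputable def shi (u : FuzzyNumber) (α : ℝ) : ℝ :=
  if α < 1 then sSup (u.hi '' Set.Ioc α 1) else u.hi 1

/-- The sup-min convolution `u∇v` of two fuzzy numbers, as a function on `ℝ`:
`(u∇v)(x) = sup_y min (u y) (v (x - y))`.  Its cut functions satisfy
`(u∇v)⁻(α) = u⁻(α) + v⁻(α)` and `(u∇v)⁺(α) = u⁺(α) + v⁺(α)`. -/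
noncomputable def conv (u v : FuzzyNumber) (x : ℝ) : ℝ :=
  ⨆ y : ℝ, min (u.f y) (v.f (x - y))

end FuzzyNumber

/-- `f` has left derivative `f'` at `x`. -/
def HasLeftDerivAt (f : ℝ → ℝ) (f' x : ℝ) : Prop :=
  HasDerivWithinAt f f' (Set.Iio x) x

/-- `f` has right derivative `f'` at `x`. -/
def HasRightDerivAt (f : ℝ → ℝ) (f' x : ℝ) : Prop :=
  HasDerivWithinAt f f' (Set.Ioi x) x

namespace FuzzyNumber

theorem bddBelow_cut (u : FuzzyNumber) {α : ℝ} (hα : α ∈ Set.Icc (0 : ℝ) 1) :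
    BddBelow (u.cut α) := by
  unfold cut
  split_ifs with h
  · obtain ⟨a, b, -, h⟩ := u.supp_isIcc
    exact h ▸ bddBelow_Icc
  · obtain ⟨a, b, -, h⟩ := u.cut_isIcc α ⟨hα.1.lt_of_ne' h, hα.2⟩
    exact h ▸ bddBelow_Icc

theorem f_le_of_lt_lo (u : FuzzyNumber) {α x : ℝ} (hα : α ∈ Set.Icc (0 : ℝ) 1)
    (hx : x < u.lo α) : u.f x ≤ α := by
  by_contra! hlt
  refine hx.not_ge (csInf_le (u.bddBelow_cut hα) ?_)
  unfold cut
  split_ifs with h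
  · exact subset_closure (h ▸ hlt)
  · exact hlt.le

theorem le_f_lo (u : FuzzyNumber) {α : ℝ} (hα : α ∈ Set.Icc (0 : ℝ) 1) :
    α ≤ u.f (u.lo α) := by
  rcases hα.1.eq_or_lt with rfl | hpos
  · exact (u.mem_Icc _).1
  · obtain ⟨a, b, hab, h⟩ := u.cut_isIcc α ⟨hpos, hα.2⟩
    have hlo : u.lo α = a := by
      rw [lo, cut, if_neg hpos.ne', h, csInf_Icc hab]
    have ha : a ∈ {x | α ≤ u.f x} := h ▸ left_mem_Icc.2 hab
    rwa [hlo]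

theorem min_le_conv (u v : FuzzyNumber) (x y : ℝ) :
    min (u.f y) (v.f (x - y)) ≤ u.conv v x :=
  le_ciSup (f := fun y => min (u.f y) (v.f (x - y)))
    ⟨1, by rintro _ ⟨z, rfl⟩; exact min_le_of_left_le (u.mem_Icc z).2⟩ y

/-- Left continuity of `f` at the endpoint `lo α` forces the value `α` there. -/
theorem f_lo_eq (u : FuzzyNumber) {α : ℝ} (hα : α ∈ Set.Icc (0 : ℝ) 1)
    (hc : ContinuousWithinAt u.f (Set.Iio (u.lo α)) (u.lo α)) : u.f (u.lo α) = α :=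
  le_antisymm
    (le_of_tendsto hc (eventually_nhdsWithin_of_forall fun _ hx => u.f_le_of_lt_lo hα hx))
    (u.le_f_lo hα)

theorem conv_le_of_le (u v : FuzzyNumber) {α x : ℝ} (hα : α ∈ Set.Icc (0 : ℝ) 1)
    (hv : v.f (v.lo α) = α) (hx : x ≤ u.lo α + v.lo α) : u.conv v x ≤ α := by
  refine ciSup_le fun y => ?_
  rcases lt_or_ge y (u.lo α) with hy | hy
  · exact min_le_of_left_le (u.f_le_of_lt_lo hα hy)
  · refine min_le_of_right_le ?_
    rcases (show x - y ≤ v.lo α by linarith).eq_or_lt with h | h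
    · rw [h, hv]
    · exact v.f_le_of_lt_lo hα h

theorem f_sub_lo_le_conv (u v : FuzzyNumber) {α x : ℝ} (hα : α ∈ Set.Icc (0 : ℝ) 1)
    (hx : v.f (x - u.lo α) ≤ α) : v.f (x - u.lo α) ≤ u.conv v x :=
  (le_min (hx.trans (u.le_f_lo hα)) le_rfl).trans (u.min_le_conv v x (u.lo α))

end FuzzyNumber

/-- Theorem `dzeron`(i): if `v'₋(v⁻(α)) = 0` then
`(u∇v)'₋((u∇v)⁻(α)) = 0`. -/
theorem conv_leftDeriv_zero (u v : FuzzyNumber) (α : ℝ) (hα : α ∈ Set.Icc (0 : ℝ) 1)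
    (hv : HasLeftDerivAt v.f 0 (v.lo α)) :
    HasLeftDerivAt (u.conv v) 0 (u.lo α + v.lo α) := by
  have hval := v.f_lo_eq hα hv.continuousWithinAt
  have hs : u.conv v (u.lo α + v.lo α) = α := by
    refine le_antisymm (u.conv_le_of_le v hα hval le_rfl) ?_
    have h := u.f_sub_lo_le_conv v (x := u.lo α + v.lo α) hα (by simp [hval])
    simpa [hval] using h
  have hshift : HasDerivWithinAt (fun x => v.f (x - u.lo α)) 0
      (Set.Iio (u.lo α + v.lo α)) (u.lo α + v.lo α) := by
    have h := HasDerivWithinAt.scomp_of_eq (u.lo α + v.lo α) hv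
      ((hasDerivWithinAt_id (u.lo α + v.lo α) (Set.Iio (u.lo α + v.lo α))).sub_const (u.lo α))
      (fun x hx => by simp only [Set.mem_Iio, id] at hx ⊢; linarith) (by simp)
    simpa [Function.comp_def] using h
  rw [HasLeftDerivAt, hasDerivWithinAt_iff_isLittleO]
  refine Asymptotics.IsBigO.trans_isLittleO ?_ (hasDerivWithinAt_iff_isLittleO.1 hshift)
  refine Asymptotics.IsBigO.of_bound 1 (eventually_nhdsWithin_of_forall fun x hx => ?_)
  have hx' : x < u.lo α + v.lo α := hx
  have h₁ := v.f_le_of_lt_lo (x := x - u.lo α) hα (by linarith)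
  have h₂ := u.f_sub_lo_le_conv v hα h₁
  have h₃ := u.conv_le_of_le v hα hval hx'.le
  simp only [hs, add_sub_cancel_left, hval, smul_zero, sub_zero, one_mul, Real.norm_eq_abs]
  rw [abs_of_nonpos (by linarith), abs_of_nonpos (by linarith)]
  linarith
end

section
/- Let u and v be fuzzy numbers and let α ∈ [0,1]. If the right derivatives satisfy u'₊(u⁻(α)) = φ > 0 and v'₊(v⁻(α)) = ψ > 0, and moreover u(u⁻(α)) = v(v⁻(α)) = β, then the right derivative of u∇v at (u∇v)⁻(β) equals (φ⁻¹ + ψ⁻¹)⁻¹, i.e., (u∇v)'₊((u∇v)⁻(β)) = (φ⁻¹ + ψ⁻¹)⁻¹. -/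
open Set Filter Topology

/-- Every cut of level in `[0, 1]` has its `lo` as least element. -/
theorem FuzzyNumber.isLeast_lo (u : FuzzyNumber) {α : ℝ} (hα : α ∈ Set.Icc (0 : ℝ) 1) :
    IsLeast (u.cut α) (u.lo α) := by
  obtain ⟨a, b, hab, h⟩ : ∃ a b : ℝ, a ≤ b ∧ u.cut α = Set.Icc a b := by
    unfold FuzzyNumber.cut
    split_ifs with h0
    · exact u.supp_isIcc
    · exact u.cut_isIcc α ⟨lt_of_le_of_ne hα.1 (Ne.symm h0), hα.2⟩
  rw [FuzzyNumber.lo, h, csInf_Icc hab]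
  exact isLeast_Icc hab

theorem FuzzyNumber.mem_cut_of_le (u : FuzzyNumber) {α x : ℝ} (h : α ≤ u.f x)
    (hx : 0 < u.f x) : x ∈ u.cut α := by
  unfold FuzzyNumber.cut
  split_ifs
  · exact subset_closure hx
  · exact h

/-- Replacing a level by the value attained at its left endpoint keeps that endpoint. -/
theorem FuzzyNumber.lo_apply_lo (u : FuzzyNumber) {α : ℝ} (hα : α ∈ Set.Icc (0 : ℝ) 1) :
    u.lo (u.f (u.lo α)) = u.lo α := by
  have hl := u.isLeast_lo hα
  have hle : α ≤ u.f (u.lo α) := by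
    by_cases h0 : α = 0
    · rw [h0]
      exact (u.mem_Icc _).1
    · have h := hl.1
      simp only [FuzzyNumber.cut, if_neg h0] at h
      exact h
  rcases (u.mem_Icc (u.lo α)).1.eq_or_lt with hβ | hβ
  · rw [← hβ, le_antisymm (hβ ▸ hle) hα.1]
  · refine (u.isLeast_lo (u.mem_Icc _)).unique ⟨u.mem_cut_of_le le_rfl hβ, fun x hx => hl.2 ?_⟩
    simp only [FuzzyNumber.cut, if_neg hβ.ne'] at hx
    exact u.mem_cut_of_le (hle.trans hx) (hβ.trans_le hx)

theorem FuzzyNumber.exists_eq_one (u : FuzzyNumber) : ∃ c, u.f c = 1 := by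
  obtain ⟨a, b, hab, h⟩ := u.cut_isIcc 1 ⟨one_pos, le_rfl⟩
  have ha : a ∈ {x | 1 ≤ u.f x} := h ▸ Set.left_mem_Icc.2 hab
  exact ⟨a, le_antisymm (u.mem_Icc a).2 ha⟩

/-- A fuzzy number is nondecreasing to the left of any point of its core. -/
theorem FuzzyNumber.monotoneOn_Iic (u : FuzzyNumber) {c : ℝ} (hc : u.f c = 1) :
    MonotoneOn u.f (Set.Iic c) := by
  intro x _ y hy hxy
  rcases (u.mem_Icc x).1.eq_or_lt with h | h
  · rw [← h]
    exact (u.mem_Icc y).1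
  · obtain ⟨a, b, -, hcut⟩ := u.cut_isIcc (u.f x) ⟨h, (u.mem_Icc x).2⟩
    have hx' : x ∈ Set.Icc a b := hcut ▸ (le_refl (u.f x))
    have hc' : c ∈ Set.Icc a b := by
      rw [← hcut]
      simpa [hc] using (u.mem_Icc x).2
    have hy' : y ∈ {z | u.f x ≤ u.f z} := hcut ▸ ⟨hx'.1.trans hxy, le_trans hy hc'.2⟩
    exact hy'

/-- A fuzzy number with positive right derivative at a left endpoint is nondecreasing up to
some point strictly to the right of it. -/
theorem FuzzyNumber.exists_lo_lt_monotoneOn (u : FuzzyNumber) {α φ : ℝ}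
    (hα : α ∈ Set.Icc (0 : ℝ) 1) (hφ : 0 < φ) (hu : HasRightDerivAt u.f φ (u.lo α)) :
    ∃ c, u.lo α < c ∧ MonotoneOn u.f (Set.Iic c) := by
  obtain ⟨c, hc⟩ := u.exists_eq_one
  refine ⟨c, lt_of_le_of_ne ((u.isLeast_lo hα).2 ?_) ?_, u.monotoneOn_Iic hc⟩
  · exact u.mem_cut_of_le (hc ▸ hα.2) (hc ▸ one_pos)
  · intro h
    have ht := (hasDerivWithinAt_iff_tendsto_slope' self_notMem_Ioi).1 hu
    refine hφ.not_ge (le_of_tendsto ht ?_)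
    filter_upwards [self_mem_nhdsWithin] with x hx
    rw [slope_def_field, h, hc]
    rw [h] at hx
    exact div_nonpos_of_nonpos_of_nonneg (sub_nonpos.2 (u.mem_Icc x).2)
      (sub_nonneg.2 (le_of_lt hx))

theorem FuzzyNumber.min_le_conv_s3 (u v : FuzzyNumber) (x y : ℝ) :
    min (u.f y) (v.f (x - y)) ≤ u.conv v x :=
  le_ciSup (f := fun y => min (u.f y) (v.f (x - y)))
    ⟨1, by rintro _ ⟨z, rfl⟩; exact (min_le_left _ _).trans (u.mem_Icc z).2⟩ y

theorem FuzzyNumber.conv_le_max (u v : FuzzyNumber) {x y c d : ℝ}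
    (hu : MonotoneOn u.f (Set.Iic c)) (hv : MonotoneOn v.f (Set.Iic d))
    (hy : y ≤ c) (hxy : x - y ≤ d) :
    u.conv v x ≤ max (u.f y) (v.f (x - y)) := by
  refine ciSup_le fun z => ?_
  rcases le_total z y with h | h
  · exact (min_le_left _ _).trans ((hu (h.trans hy) hy h).trans (le_max_left _ _))
  · have h' : x - z ≤ x - y := by linarith
    exact (min_le_right _ _).trans ((hv (h'.trans hxy) hxy h').trans (le_max_right _ _))

/-- A function squeezed between the minimum and the maximum of two functions that share their
value and one-sided derivative at `x` has the same right derivative. -/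
theorem HasRightDerivAt.of_min_le_of_le_max {f g h : ℝ → ℝ} {K x : ℝ}
    (hf : HasRightDerivAt f K x) (hg : HasRightDerivAt g K x) (hfg : f x = g x)
    (hmin : ∀ᶠ y in 𝓝[≥] x, min (f y) (g y) ≤ h y)
    (hmax : ∀ᶠ y in 𝓝[≥] x, h y ≤ max (f y) (g y)) : HasRightDerivAt h K x := by
  have hx : h x = f x := by
    have h1 := hmin.self_of_nhdsWithin Set.self_mem_Ici
    have h2 := hmax.self_of_nhdsWithin Set.self_mem_Ici
    rw [← hfg, min_self] at h1
    rw [← hfg, max_self] at h2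
    exact le_antisymm h2 h1
  have hle : 𝓝[>] x ≤ 𝓝[≥] x := nhdsWithin_mono x Set.Ioi_subset_Ici_self
  unfold HasRightDerivAt at *
  rw [hasDerivWithinAt_iff_isLittleO] at *
  refine Asymptotics.IsBigO.trans_isLittleO ?_ (hf.norm_left.add hg.norm_left)
  refine Asymptotics.IsBigO.of_bound 1 ?_
  filter_upwards [hle hmin, hle hmax] with y h1 h2
  rw [one_mul, hx, ← hfg]
  simp only [Real.norm_eq_abs]
  refine le_trans ?_ (le_abs_self _)
  set k := (y - x) • K
  have a1 := le_abs_self (f y - f x - k)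
  have a2 := neg_abs_le (f y - f x - k)
  have a3 := le_abs_self (g y - f x - k)
  have a4 := neg_abs_le (g y - f x - k)
  have a5 := abs_nonneg (f y - f x - k)
  have a6 := abs_nonneg (g y - f x - k)
  rw [abs_le]
  constructor
  · rcases min_le_iff.1 h1 with h | h <;> linarith
  · rcases le_max_iff.1 h2 with h | h <;> linarith

/-- Chain rule for the right derivative along `y ↦ a + p * (y - x)` with `p > 0`. -/
theorem HasRightDerivAt.comp_affine {f : ℝ → ℝ} {f' a p : ℝ} (hf : HasRightDerivAt f f' a)
    (hp : 0 < p) (x : ℝ) : HasRightDerivAt (fun y => f (a + p * (y - x))) (f' * p) x := by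
  have hl : HasDerivWithinAt (fun y => a + p * (y - x)) p (Set.Ioi x) x := by
    simpa using ((((hasDerivAt_id x).sub_const x).const_mul p).const_add a).hasDerivWithinAt
  refine HasDerivWithinAt.comp (s' := Set.Ioi a) x (by simpa [HasRightDerivAt] using hf) hl ?_
  intro y hy
  have : 0 < p * (y - x) := mul_pos hp (sub_pos.2 hy)
  simpa using this

/-- Theorem `dbzeron`(ii): if `u'₊(u⁻(α)) = φ > 0`,
`v'₊(v⁻(α)) = ψ > 0` and `u(u⁻(α)) = v(v⁻(α)) = β`, then
`(u∇v)'₊((u∇v)⁻(β)) = (φ⁻¹ + ψ⁻¹)⁻¹`. -/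
theorem conv_rightDeriv_harmonic (u v : FuzzyNumber) (α β φ ψ : ℝ)
    (hα : α ∈ Set.Icc (0 : ℝ) 1) (hφ : 0 < φ) (hψ : 0 < ψ)
    (hu : HasRightDerivAt u.f φ (u.lo α)) (hv : HasRightDerivAt v.f ψ (v.lo α))
    (hu1 : u.f (u.lo α) = β) (hv1 : v.f (v.lo α) = β) :
    HasRightDerivAt (u.conv v) (φ⁻¹ + ψ⁻¹)⁻¹ (u.lo β + v.lo β) := by
  have hsum : 0 < φ + ψ := add_pos hφ hψ
  obtain ⟨c, hc, hcu⟩ := u.exists_lo_lt_monotoneOn hα hφ hu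
  obtain ⟨d, hd, hdv⟩ := v.exists_lo_lt_monotoneOn hα hψ hv
  rw [show u.lo β = u.lo α from hu1 ▸ u.lo_apply_lo hα,
    show v.lo β = v.lo α from hv1 ▸ v.lo_apply_lo hα]
  set a := u.lo α
  set b := v.lo α
  have hU := hu.comp_affine (div_pos hψ hsum) (a + b)
  have hV := hv.comp_affine (div_pos hφ hsum) (a + b)
  rw [show φ * (ψ / (φ + ψ)) = (φ⁻¹ + ψ⁻¹)⁻¹ by field_simp; ring] at hU
  rw [show ψ * (φ / (φ + ψ)) = (φ⁻¹ + ψ⁻¹)⁻¹ by field_simp; ring] at hV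
  have hsplit (x : ℝ) : x - (a + ψ / (φ + ψ) * (x - (a + b))) =
      b + φ / (φ + ψ) * (x - (a + b)) := by
    field_simp
    ring
  have hnear {e m p : ℝ} (hem : e < m) :
      ∀ᶠ x in 𝓝[≥] (a + b), e + p * (x - (a + b)) ≤ m := by
    have hcont : ContinuousAt (fun x => e + p * (x - (a + b))) (a + b) := by fun_prop
    exact (hcont.eventually_lt_const (by simpa using hem)).filter_mono nhdsWithin_le_nhds
      |>.mono fun _ => le_of_lt
  refine hU.of_min_le_of_le_max hV (by simp [hu1, hv1]) (.of_forall fun x => ?_) ?_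
  · rw [← hsplit]
    exact u.min_le_conv_s3 v x _
  · filter_upwards [hnear hc, hnear hd] with x hxc hxd
    rw [← hsplit] at hxd ⊢
    exact u.conv_le_max v hcu hdv hxc hxd
end

section
/- Let u and v be fuzzy numbers and let α ∈ [0,1]. Then (u∇v)((u∇v)⁻(α)) = min(u(u⁻(α)), v(v⁻(α))) and (u∇v)((u∇v)⁺(α)) = min(u(u⁺(α)), v(v⁺(α))). -/
open Set Filter Topology

namespace FuzzyNumber

theorem cut_eq_Icc (u : FuzzyNumber) {α : ℝ} (hα : α ∈ Set.Icc (0 : ℝ) 1) :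
    u.lo α ≤ u.hi α ∧ u.cut α = Set.Icc (u.lo α) (u.hi α) := by
  obtain ⟨a, b, hab, h⟩ : ∃ a b : ℝ, a ≤ b ∧ u.cut α = Set.Icc a b := by
    unfold cut
    split_ifs with h0
    · exact u.supp_isIcc
    · exact u.cut_isIcc α ⟨lt_of_le_of_ne hα.1 (Ne.symm h0), hα.2⟩
  rw [lo, hi, h, csInf_Icc hab, csSup_Icc hab]
  exact ⟨hab, rfl⟩

theorem le_of_mem_cut (u : FuzzyNumber) {α x : ℝ} (hx : x ∈ u.cut α) : α ≤ u.f x := by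
  unfold cut at hx
  split_ifs at hx with h0
  · exact h0 ▸ (u.mem_Icc x).1
  · exact hx

theorem le_of_notMem_cut (u : FuzzyNumber) {α x : ℝ} (hx : x ∉ u.cut α) : u.f x ≤ α := by
  contrapose! hx
  unfold cut
  split_ifs with h0
  · exact subset_closure (h0 ▸ hx)
  · exact hx.le

theorem le_f_hi (u : FuzzyNumber) {α : ℝ} (hα : α ∈ Set.Icc (0 : ℝ) 1) :
    α ≤ u.f (u.hi α) := by
  obtain ⟨hle, hcut⟩ := u.cut_eq_Icc hα
  exact u.le_of_mem_cut (hcut ▸ Set.right_mem_Icc.2 hle)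

theorem f_le_of_hi_lt (u : FuzzyNumber) {α x : ℝ} (hα : α ∈ Set.Icc (0 : ℝ) 1)
    (hx : u.hi α < x) : u.f x ≤ α := by
  refine u.le_of_notMem_cut fun h => ?_
  rw [(u.cut_eq_Icc hα).2] at h
  exact hx.not_ge h.2

/-- If both factors are at least `α` at `p` and `q`, and every other decomposition of `p + q`
has a factor at most `α`, then the supremum defining `u.conv v (p + q)` is attained at `p`. -/
theorem conv_add_eq_min (u v : FuzzyNumber) {α p q : ℝ} (hp : α ≤ u.f p) (hq : α ≤ v.f q)
    (h : ∀ y, y ≠ p → u.f y ≤ α ∨ v.f (p + q - y) ≤ α) :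
    u.conv v (p + q) = min (u.f p) (v.f q) := by
  have hbound : ∀ y, min (u.f y) (v.f (p + q - y)) ≤ min (u.f p) (v.f q) := by
    intro y
    rcases eq_or_ne y p with rfl | hy
    · rw [add_sub_cancel_left]
    · exact (min_le_iff.2 (h y hy)).trans (le_min hp hq)
  refine le_antisymm (ciSup_le hbound) ?_
  refine le_ciSup_of_le ⟨_, Set.forall_mem_range.2 hbound⟩ p ?_
  rw [add_sub_cancel_left]

end FuzzyNumber

/-- Lemma `evf`: the value of `u∇v` at the endpoints of its
`α`-cut: `(u∇v)((u∇v)⁻(α)) = min (u(u⁻(α))) (v(v⁻(α)))` and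
`(u∇v)((u∇v)⁺(α)) = min (u(u⁺(α))) (v(v⁺(α)))`. -/
theorem conv_value_at_endpoints (u v : FuzzyNumber) (α : ℝ)
    (hα : α ∈ Set.Icc (0 : ℝ) 1) :
    u.conv v (u.lo α + v.lo α) = min (u.f (u.lo α)) (v.f (v.lo α)) ∧
    u.conv v (u.hi α + v.hi α) = min (u.f (u.hi α)) (v.f (v.hi α)) := by
  constructor
  · refine u.conv_add_eq_min v (u.le_f_lo hα) (v.le_f_lo hα) fun y hy => ?_
    rcases hy.lt_or_gt with hy | hy
    · exact Or.inl (u.f_le_of_lt_lo hα hy)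
    · exact Or.inr (v.f_le_of_lt_lo hα (by linarith))
  · refine u.conv_add_eq_min v (u.le_f_hi hα) (v.le_f_hi hα) fun y hy => ?_
    rcases hy.lt_or_gt with hy | hy
    · exact Or.inr (v.f_le_of_hi_lt hα (by linarith))
    · exact Or.inl (u.f_le_of_hi_lt hα hy)
end

section
/- Let u be a fuzzy number with u(u⁻(0)) = α₀ and u(u⁺(0)) = β₀. Then u belongs to F_C(ℝ) if and only if u⁻ is strictly increasing on [α₀, 1] and u⁺ is strictly decreasing on [β₀, 1]. -/
open Set Filter Topology

namespace FuzzyNumber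

variable (u : FuzzyNumber)

theorem closure_support_eq_Icc : closure {x | 0 < u.f x} = Icc (u.lo 0) (u.hi 0) := by
  obtain ⟨a, b, hab, h⟩ := u.supp_isIcc
  simp [lo, hi, cut, h, csInf_Icc hab, csSup_Icc hab]

theorem le_f_iff {α : ℝ} (h0 : 0 < α) (h1 : α ≤ 1) (x : ℝ) :
    α ≤ u.f x ↔ x ∈ Icc (u.lo α) (u.hi α) := by
  obtain ⟨a, b, hab, h⟩ := u.cut_isIcc α ⟨h0, h1⟩
  simp only [lo, hi, cut, h0.ne', if_false, h, csInf_Icc hab, csSup_Icc hab]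
  exact Set.ext_iff.1 h x

theorem lo_le_hi {α : ℝ} (h0 : 0 < α) (h1 : α ≤ 1) : u.lo α ≤ u.hi α := by
  obtain ⟨a, b, hab, h⟩ := u.cut_isIcc α ⟨h0, h1⟩
  simpa [lo, hi, cut, h0.ne', h, csInf_Icc hab, csSup_Icc hab] using hab

theorem le_f_lo_s9 {α : ℝ} (h0 : 0 < α) (h1 : α ≤ 1) : α ≤ u.f (u.lo α) :=
  (u.le_f_iff h0 h1 _).2 (left_mem_Icc.2 (u.lo_le_hi h0 h1))

theorem le_f_hi_s9 {α : ℝ} (h0 : 0 < α) (h1 : α ≤ 1) : α ≤ u.f (u.hi α) :=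
  (u.le_f_iff h0 h1 _).2 (right_mem_Icc.2 (u.lo_le_hi h0 h1))

theorem mem_Icc_of_pos {x : ℝ} (hx : 0 < u.f x) : x ∈ Icc (u.lo 0) (u.hi 0) :=
  u.closure_support_eq_Icc ▸ subset_closure hx

theorem le_f_of_mem_Icc {α x y z : ℝ} (h0 : 0 < α) (hx : α ≤ u.f x) (hz : α ≤ u.f z)
    (hy : y ∈ Icc x z) : α ≤ u.f y := by
  have h1 : α ≤ 1 := hx.trans (u.mem_Icc x).2
  rw [u.le_f_iff h0 h1] at hx hz ⊢
  exact ⟨hx.1.trans hy.1, hy.2.trans hz.2⟩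

theorem upperSemicontinuous_f : UpperSemicontinuous u.f := by
  rw [upperSemicontinuous_iff_isClosed_preimage]
  intro α
  rcases le_or_gt α 0 with h0 | h0
  · convert isClosed_univ
    exact eq_univ_of_forall fun x => h0.trans (u.mem_Icc x).1
  · rcases le_or_gt α 1 with h1 | h1
    · convert isClosed_Icc (a := u.lo α) (b := u.hi α)
      ext x
      exact u.le_f_iff h0 h1 x
    · convert isClosed_empty
      exact eq_empty_of_forall_notMem fun x hx => (h1.trans_le hx).not_ge (u.mem_Icc x).2

theorem strictMonoOn_lo (h : ContinuousOn u.f (Icc (u.lo 0) (u.hi 0))) :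
    StrictMonoOn u.lo (Icc (u.f (u.lo 0)) 1) := by
  intro α hα β hβ hαβ
  by_contra! hle
  have hα0 : 0 ≤ α := (u.mem_Icc _).1.trans hα.1
  have hβ0 : 0 < β := hα0.trans_lt hαβ
  have hfβ := u.le_f_lo_s9 hβ0 hβ.2
  have hmem := u.mem_Icc_of_pos (hβ0.trans_le hfβ)
  have hlt : u.lo 0 < u.lo β := by
    refine hmem.1.lt_of_ne fun heq => ?_
    rw [← heq] at hfβ
    linarith [hα.1]
  have hαpos : 0 < α := by
    refine hα0.lt_of_ne fun heq => ?_
    rw [← heq] at hle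
    linarith
  have hev := ((h _ hmem).mono
    (Ioo_subset_Icc_self.trans (Icc_subset_Icc_right hmem.2))).eventually_const_lt
    (hαβ.trans_le hfβ)
  have : (𝓝[Ioo (u.lo 0) (u.lo β)] (u.lo β)).NeBot := right_nhdsWithin_Ioo_neBot hlt
  obtain ⟨y, hy, hyI⟩ := (hev.and self_mem_nhdsWithin).exists
  have := ((u.le_f_iff hαpos hα.2 y).1 hy.le).1
  linarith [hyI.2]

theorem strictAntiOn_hi (h : ContinuousOn u.f (Icc (u.lo 0) (u.hi 0))) :
    StrictAntiOn u.hi (Icc (u.f (u.hi 0)) 1) := by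
  intro α hα β hβ hαβ
  by_contra! hle
  have hα0 : 0 ≤ α := (u.mem_Icc _).1.trans hα.1
  have hβ0 : 0 < β := hα0.trans_lt hαβ
  have hfβ := u.le_f_hi_s9 hβ0 hβ.2
  have hmem := u.mem_Icc_of_pos (hβ0.trans_le hfβ)
  have hlt : u.hi β < u.hi 0 := by
    refine hmem.2.lt_of_ne fun heq => ?_
    rw [heq] at hfβ
    linarith [hα.1]
  have hαpos : 0 < α := by
    refine hα0.lt_of_ne fun heq => ?_
    rw [← heq] at hle
    linarith
  have hev := ((h _ hmem).mono
    (Ioo_subset_Icc_self.trans (Icc_subset_Icc_left hmem.1))).eventually_const_lt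
    (hαβ.trans_le hfβ)
  have : (𝓝[Ioo (u.hi β) (u.hi 0)] (u.hi β)).NeBot := left_nhdsWithin_Ioo_neBot hlt
  obtain ⟨y, hy, hyI⟩ := (hev.and self_mem_nhdsWithin).exists
  have := ((u.le_f_iff hαpos hα.2 y).1 hy.le).2
  linarith [hyI.1]

theorem exists_lt_forall_le_f (h : StrictMonoOn u.lo (Icc (u.f (u.lo 0)) 1)) {d x : ℝ}
    (hd : 0 < d) (hdx : d < u.f x) :
    ∃ a < x, ∀ y ∈ Icc (u.lo 0) x, a < y → d ≤ u.f y := by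
  have hx1 := (u.mem_Icc x).2
  rcases le_total d (u.f (u.lo 0)) with hle | hle
  · exact ⟨x - 1, sub_one_lt x, fun y hy _ => u.le_f_of_mem_Icc hd hle hdx.le hy⟩
  · refine ⟨u.lo d, ?_, fun y hy hay => u.le_f_of_mem_Icc hd
      (u.le_f_lo_s9 hd (hdx.le.trans hx1)) hdx.le ⟨hay.le, hy.2⟩⟩
    exact (h ⟨hle, hdx.le.trans hx1⟩ ⟨hle.trans hdx.le, hx1⟩ hdx).trans_le
      ((u.le_f_iff (hd.trans hdx) hx1 x).1 le_rfl).1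

theorem exists_gt_forall_le_f (h : StrictAntiOn u.hi (Icc (u.f (u.hi 0)) 1)) {d x : ℝ}
    (hd : 0 < d) (hdx : d < u.f x) :
    ∃ b > x, ∀ y ∈ Icc x (u.hi 0), y < b → d ≤ u.f y := by
  have hx1 := (u.mem_Icc x).2
  rcases le_total d (u.f (u.hi 0)) with hle | hle
  · exact ⟨x + 1, lt_add_one x, fun y hy _ => u.le_f_of_mem_Icc hd hdx.le hle hy⟩
  · refine ⟨u.hi d, ?_, fun y hy hyb => u.le_f_of_mem_Icc hd hdx.le
      (u.le_f_hi_s9 hd (hdx.le.trans hx1)) ⟨hy.1, hyb.le⟩⟩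
    exact ((u.le_f_iff (hd.trans hdx) hx1 x).1 le_rfl).2.trans_lt
      (h ⟨hle, hdx.le.trans hx1⟩ ⟨hle.trans hdx.le, hx1⟩ hdx)

theorem lowerSemicontinuousOn_f (hlo : StrictMonoOn u.lo (Icc (u.f (u.lo 0)) 1))
    (hhi : StrictAntiOn u.hi (Icc (u.f (u.hi 0)) 1)) :
    LowerSemicontinuousOn u.f (Icc (u.lo 0) (u.hi 0)) := by
  intro x _ c hc
  rcases lt_or_ge c 0 with hc0 | hc0
  · exact Eventually.of_forall fun y => hc0.trans_le (u.mem_Icc y).1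
  obtain ⟨d, hcd, hdx⟩ := exists_between hc
  obtain ⟨a, hax, ha⟩ := u.exists_lt_forall_le_f hlo (hc0.trans_lt hcd) hdx
  obtain ⟨b, hxb, hb⟩ := u.exists_gt_forall_le_f hhi (hc0.trans_lt hcd) hdx
  filter_upwards [self_mem_nhdsWithin, mem_nhdsWithin_of_mem_nhds (Ioo_mem_nhds hax hxb)]
    with y hy hyab
  refine hcd.trans_le ?_
  rcases le_total y x with hyx | hxy
  · exact ha y ⟨hy.1, hyx⟩ hyab.1
  · exact hb y ⟨hxy, hy.2⟩ hyab.2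

end FuzzyNumber

/-- Theorem `smn`: with `α₀ = u(u⁻(0))` and `β₀ = u(u⁺(0))`,
`u ∈ F_C(ℝ)` iff `u⁻` is strictly increasing on `[α₀,1]` and `u⁺` is strictly
decreasing on `[β₀,1]`. -/
theorem memFC_iff_strictMono (u : FuzzyNumber) (α₀ β₀ : ℝ)
    (hα₀ : u.f (u.lo 0) = α₀) (hβ₀ : u.f (u.hi 0) = β₀) :
    ContinuousOn u.f (Set.Icc (u.lo 0) (u.hi 0)) ↔
      (StrictMonoOn u.lo (Set.Icc α₀ 1) ∧ StrictAntiOn u.hi (Set.Icc β₀ 1)) := by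
  subst hα₀ hβ₀
  refine ⟨fun h => ⟨u.strictMonoOn_lo h, u.strictAntiOn_hi h⟩, fun ⟨hlo, hhi⟩ => ?_⟩
  exact continuousOn_iff_lower_upperSemicontinuousOn.2
    ⟨u.lowerSemicontinuousOn_f hlo hhi, u.upperSemicontinuous_f.upperSemicontinuousOn _⟩
end

section
/- Let u ∈ F_C(ℝ) and let v be a fuzzy number. If u(u⁻(0)) ≤ v(v⁻(0)) and u(u⁺(0)) ≤ v(v⁺(0)), then u∇v ∈ F_C(ℝ). -/
open Set Filter Topology

namespace FuzzyNumber

theorem lo_zero_le_and_le_hi_zero (u : FuzzyNumber) {y : ℝ} (hy : 0 < u.f y) :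
    u.lo 0 ≤ y ∧ y ≤ u.hi 0 := by
  obtain ⟨a, b, hab, h⟩ := u.supp_isIcc
  have hmem : y ∈ Set.Icc a b := h ▸ subset_closure hy
  simpa [lo, hi, cut, h, csInf_Icc hab, csSup_Icc hab] using hmem

theorem isCompact_superlevel (u : FuzzyNumber) {α : ℝ} (hα : 0 < α) :
    IsCompact {x | α ≤ u.f x} := by
  rcases le_or_gt α 1 with h | h
  · obtain ⟨a, b, -, hc⟩ := u.cut_isIcc α ⟨hα, h⟩
    exact hc ▸ isCompact_Icc
  · have hempty : {x | α ≤ u.f x} = ∅ :=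
      Set.eq_empty_of_forall_notMem fun x hx => (h.trans_le hx).not_ge (u.mem_Icc x).2
    exact hempty ▸ isCompact_empty

theorem lt_of_mem_Icc (u : FuzzyNumber) {t p q r : ℝ} (ht : 0 ≤ t) (hp : t < u.f p)
    (hr : t < u.f r) (hq : q ∈ Set.Icc p r) : t < u.f q := by
  have hmin : t < min (u.f p) (u.f r) := lt_min hp hr
  obtain ⟨a, b, -, hc⟩ := u.cut_isIcc (min (u.f p) (u.f r))
    ⟨ht.trans_lt hmin, (min_le_left _ _).trans (u.mem_Icc p).2⟩
  have hpc : p ∈ Set.Icc a b := hc ▸ min_le_left (u.f p) (u.f r)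
  have hrc : r ∈ Set.Icc a b := hc ▸ min_le_right (u.f p) (u.f r)
  have hqc : q ∈ {x | min (u.f p) (u.f r) ≤ u.f x} :=
    hc ▸ ⟨hpc.1.trans hq.1, hq.2.trans hrc.2⟩
  exact hmin.trans_le hqc

theorem conv_nonneg (u v : FuzzyNumber) (x : ℝ) : 0 ≤ u.conv v x :=
  (le_min (u.mem_Icc 0).1 (v.mem_Icc _).1).trans (u.min_le_conv v x 0)

theorem upperSemicontinuous_conv (u v : FuzzyNumber) : UpperSemicontinuous (u.conv v) := by
  intro x t ht
  obtain ⟨s, hxs, hst⟩ := exists_between ht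
  have hs : 0 < s := (u.conv_nonneg v x).trans_lt hxs
  let K := (fun p : ℝ × ℝ => p.1 + p.2) '' ({y | s ≤ u.f y} ×ˢ {z | s ≤ v.f z})
  have hK : IsClosed K :=
    (((u.isCompact_superlevel hs).prod (v.isCompact_superlevel hs)).image
      continuous_add).isClosed
  have hxK : x ∉ K := by
    rintro ⟨⟨y, z⟩, ⟨hy, hz⟩, rfl⟩
    refine hxs.not_ge ((le_min hy ?_).trans (u.min_le_conv v _ y))
    simpa using hz
  filter_upwards [hK.isOpen_compl.mem_nhds hxK] with x' hx'
  refine (ciSup_le fun y => ?_).trans_lt hst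
  by_contra! h
  exact hx' ⟨(y, x' - y), ⟨h.le.trans (min_le_left _ _), h.le.trans (min_le_right _ _)⟩,
    add_sub_cancel _ _⟩

theorem lowerSemicontinuousOn_conv (u v : FuzzyNumber)
    (huC : ContinuousOn u.f (Set.Icc (u.lo 0) (u.hi 0)))
    (h1 : u.f (u.lo 0) ≤ v.f (v.lo 0)) (h2 : u.f (u.hi 0) ≤ v.f (v.hi 0)) :
    LowerSemicontinuousOn (u.conv v) (Set.Icc (u.lo 0 + v.lo 0) (u.hi 0 + v.hi 0)) := by
  intro x _ t ht
  rcases lt_or_ge t 0 with ht0 | ht0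
  · exact Eventually.of_forall fun x' => ht0.trans_le (u.conv_nonneg v x')
  obtain ⟨y, hy⟩ := exists_lt_of_lt_ciSup ht
  obtain ⟨huy, hvy⟩ := lt_min_iff.1 hy
  obtain ⟨hay, hyb⟩ := u.lo_zero_le_and_le_hi_zero (ht0.trans_lt huy)
  obtain ⟨hcz, hzd⟩ := v.lo_zero_le_and_le_hi_zero (ht0.trans_lt hvy)
  have hab := hay.trans hyb
  let g : ℝ → ℝ := fun x' => max (u.lo 0) (min (u.hi 0) (y + (x' - x)))
  have hg : Continuous g := by fun_prop
  have hgx : g x = y := by simp [g, hay, hyb]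
  have hgmem : ∀ x', g x' ∈ Set.Icc (u.lo 0) (u.hi 0) := fun x' =>
    ⟨le_max_left _ _, max_le hab (min_le_left _ _)⟩
  have hug : Continuous fun x' => u.f (g x') := huC.comp_continuous hg hgmem
  have hev : ∀ᶠ x' in 𝓝 x, t < u.f (g x') :=
    hug.continuousAt.eventually (lt_mem_nhds (by simpa only [hgx] using huy))
  filter_upwards [hev.filter_mono nhdsWithin_le_nhds, self_mem_nhdsWithin] with x' hux' hx'
  refine (lt_min hux' ?_).trans_le (u.min_le_conv v x' (g x'))
  rcases lt_or_ge (y + (x' - x)) (u.lo 0) with hlt | hge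
  · have hga : g x' = u.lo 0 := max_eq_left ((min_le_right _ _).trans hlt.le)
    rw [hga] at hux' ⊢
    exact v.lt_of_mem_Icc ht0 (hux'.trans_le h1) hvy
      ⟨by linarith [hx'.1], by linarith⟩
  rcases lt_or_ge (u.hi 0) (y + (x' - x)) with hlt | hle
  · have hgb : g x' = u.hi 0 := by simp [g, min_eq_left hlt.le, hab]
    rw [hgb] at hux' ⊢
    exact v.lt_of_mem_Icc ht0 hvy (hux'.trans_le h2)
      ⟨by linarith, by linarith [hx'.2]⟩
  · have hgy : g x' = y + (x' - x) := by simp [g, hge, hle]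
    rwa [hgy, show x' - (y + (x' - x)) = x - y by ring]

end FuzzyNumber

/-- Theorem `arp`: if `u ∈ F_C(ℝ)`, `u(u⁻(0)) ≤ v(v⁻(0))` and
`u(u⁺(0)) ≤ v(v⁺(0))`, then `u∇v ∈ F_C(ℝ)`, i.e. `u∇v` is continuous on
`[(u∇v)⁻(0), (u∇v)⁺(0)] = [u⁻(0)+v⁻(0), u⁺(0)+v⁺(0)]`. -/
theorem conv_memFC (u v : FuzzyNumber)
    (huC : ContinuousOn u.f (Set.Icc (u.lo 0) (u.hi 0)))
    (h1 : u.f (u.lo 0) ≤ v.f (v.lo 0)) (h2 : u.f (u.hi 0) ≤ v.f (v.hi 0)) :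
    ContinuousOn (u.conv v) (Set.Icc (u.lo 0 + v.lo 0) (u.hi 0 + v.hi 0)) := by
  exact continuousOn_iff_lower_upperSemicontinuousOn.2
    ⟨u.lowerSemicontinuousOn_conv v huC h1 h2,
      (u.upperSemicontinuous_conv v).upperSemicontinuousOn _⟩
end

section
/- Suppose u ∈ F_N(ℝ) ∩ F_C(ℝ) and w ∈ F_D(ℝ), and suppose w satisfies: (i) w(w⁻(0)) = u(u⁻(0)) and w(w⁺(0)) = u(u⁺(0)); (ii-1) if u⁻(1) is an interior point of [u]_0 at which u is not differentiable, then the left derivative w'₋(w⁻(1)) = 0; (ii-2) if u⁺(1) is an interior point of [u]_0 at which u is not differentiable, then the right derivative w'₊(w⁺(1)) = 0. Then u∇w ∈ F_D(ℝ). -/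
open Set Filter Topology

/-- A function lying between the minimum and the maximum of two functions with the same value and
derivative at a point has that derivative too. -/
lemma hasDerivWithinAt_of_min_le_of_le_max {F f g : ℝ → ℝ} {r x : ℝ} {s : Set ℝ}
    (hf : HasDerivWithinAt f r s x) (hg : HasDerivWithinAt g r s x)
    (hfx : f x = F x) (hgx : g x = F x)
    (hmin : ∀ᶠ t in 𝓝[s] x, min (f t) (g t) ≤ F t)
    (hmax : ∀ᶠ t in 𝓝[s] x, F t ≤ max (f t) (g t)) :
    HasDerivWithinAt F r s x := by
  rw [hasDerivWithinAt_iff_isLittleO] at *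
  refine (Asymptotics.IsBigO.of_bound 1 ?_).trans_isLittleO
    (hf.norm_norm.add hg.norm_norm).of_norm_right
  filter_upwards [hmin, hmax] with t h1 h2
  simp only [Real.norm_eq_abs, smul_eq_mul, one_mul] at *
  rw [hfx, hgx]
  set l := (t - x) * r
  rw [abs_of_nonneg (a := |f t - F x - l| + |g t - F x - l|) (by positivity), abs_le]
  have f1 := neg_abs_le (f t - F x - l)
  have f2 := le_abs_self (f t - F x - l)
  have f3 := abs_nonneg (f t - F x - l)
  have g1 := neg_abs_le (g t - F x - l)
  have g2 := le_abs_self (g t - F x - l)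
  have g3 := abs_nonneg (g t - F x - l)
  rcases min_le_iff.1 h1 with h | h <;> rcases le_max_iff.1 h2 with h' | h' <;>
    constructor <;> linarith

/-- The sup-min convolution of two real functions. -/
noncomputable def supMin (f g : ℝ → ℝ) (x : ℝ) : ℝ := ⨆ y : ℝ, min (f y) (g (x - y))

lemma supMin_comm (f g : ℝ → ℝ) : supMin f g = supMin g f := by
  funext x
  refine (Equiv.subLeft x).iSup_congr fun y => ?_
  simp [min_comm]

lemma supMin_comp_neg (f g : ℝ → ℝ) (x : ℝ) :
    supMin (fun t => f (-t)) (fun t => g (-t)) x = supMin f g (-x) := by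
  refine (Equiv.neg ℝ).iSup_congr fun y => ?_
  simp only [Equiv.neg_apply]
  congr 2
  ring

/-- `f` increases up to the value `1`, which it attains exactly on `[b, c]`, and then decreases;
moreover it is continuous on the larger interval `[a, d]`. -/
structure IsUnimodal (f : ℝ → ℝ) (a b c d : ℝ) : Prop where
  ab : a ≤ b
  bc : b ≤ c
  cd : c ≤ d
  mono : MonotoneOn f (Iic c)
  anti : AntitoneOn f (Ici b)
  eq_one : ∀ x ∈ Icc b c, f x = 1
  lt_one : ∀ x ∉ Icc b c, f x < 1
  cont : ContinuousOn f (Icc a d)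

namespace IsUnimodal

variable {f g : ℝ → ℝ} {a b c d a' b' c' d' : ℝ}

lemma le_one (hf : IsUnimodal f a b c d) (x : ℝ) : f x ≤ 1 := by
  by_cases h : x ∈ Icc b c
  · exact (hf.eq_one x h).le
  · exact (hf.lt_one x h).le

lemma left_eq_one_iff (hf : IsUnimodal f a b c d) : f a = 1 ↔ a = b := by
  constructor
  · intro h
    by_contra hne
    exact (hf.lt_one a fun h' => hne (le_antisymm hf.ab h'.1)).ne h
  · rintro rfl
    exact hf.eq_one a ⟨le_rfl, hf.bc⟩

lemma comp_neg (hf : IsUnimodal f a b c d) :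
    IsUnimodal (fun t => f (-t)) (-d) (-c) (-b) (-a) where
  ab := neg_le_neg hf.cd
  bc := neg_le_neg hf.bc
  cd := neg_le_neg hf.ab
  mono _ hx _ hy h := hf.anti (mem_Ici.2 (le_neg.1 hy)) (mem_Ici.2 (le_neg.1 hx)) (neg_le_neg h)
  anti _ hx _ hy h := hf.mono (mem_Iic.2 (neg_le.1 hy)) (mem_Iic.2 (neg_le.1 hx)) (neg_le_neg h)
  eq_one _ hx := hf.eq_one _ ⟨le_neg.1 hx.2, neg_le.1 hx.1⟩
  lt_one _ hx := hf.lt_one _ fun h => hx ⟨neg_le.1 h.2, le_neg.1 h.1⟩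
  cont := hf.cont.comp continuous_neg.continuousOn
    fun _ hx => ⟨le_neg.1 hx.2, neg_le.1 hx.1⟩

lemma supMin_le_one (hf : IsUnimodal f a b c d) (x : ℝ) : supMin f g x ≤ 1 :=
  ciSup_le fun y => (min_le_left _ _).trans (hf.le_one y)

lemma min_le_supMin (hf : IsUnimodal f a b c d) (y z : ℝ) :
    min (f y) (g z) ≤ supMin f g (y + z) := by
  have hb : BddAbove (range fun t => min (f t) (g (y + z - t))) :=
    ⟨1, by rintro _ ⟨t, rfl⟩; exact (min_le_left _ _).trans (hf.le_one t)⟩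
  simpa only [add_sub_cancel_left] using! le_ciSup hb y

lemma supMin_le_max (hf : IsUnimodal f a b c d) (hg : IsUnimodal g a' b' c' d') {y z : ℝ}
    (hy : y ≤ c) (hz : z ≤ c') : supMin f g (y + z) ≤ max (f y) (g z) := by
  refine ciSup_le fun t => ?_
  rcases le_total t y with h | h
  · exact (min_le_left _ _).trans ((hf.mono (h.trans hy) hy h).trans (le_max_left _ _))
  · have h' : y + z - t ≤ z := by linarith
    exact (min_le_right _ _).trans ((hg.mono (h'.trans hz) hz h').trans (le_max_right _ _))

lemma supMin_eq (hf : IsUnimodal f a b c d) (hg : IsUnimodal g a' b' c' d') {y z : ℝ}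
    (hy : y ≤ c) (hz : z ≤ c') (h : f y = g z) : supMin f g (y + z) = f y := by
  have h1 := hf.min_le_supMin (g := g) y z
  have h2 := hf.supMin_le_max hg hy hz
  rw [← h] at h1 h2
  simp only [min_self, max_self] at h1 h2
  exact le_antisymm h2 h1

lemma supMin_eq_one (hf : IsUnimodal f a b c d) (hg : IsUnimodal g a' b' c' d') {x : ℝ}
    (hx : x ∈ Icc (b + b') (c + c')) : supMin f g x = 1 := by
  have hbc := hf.bc
  have hbc' := hg.bc
  obtain ⟨hx1, hx2⟩ := hx
  obtain ⟨y, hy, hz⟩ : ∃ y, y ∈ Icc b c ∧ x - y ∈ Icc b' c' := by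
    refine ⟨max b (x - c'), ⟨le_max_left _ _, max_le hbc (by linarith)⟩, ?_, ?_⟩
    · rcases max_cases b (x - c') with h | h <;> rw [h.1] <;> linarith
    · linarith [le_max_right b (x - c')]
  have := hf.supMin_eq hg hy.2 hz.2 ((hf.eq_one _ hy).trans (hg.eq_one _ hz).symm)
  rwa [add_sub_cancel, hf.eq_one _ hy] at this

/-- If `f` and `g` agree at points `y` and `z` of their increasing branches and moving along the
line through `(y, z)` with direction `(k, l)`, `k + l = 1`, changes both at the rate `r`, then
the convolution has derivative `r` at `y + z`. -/
lemma hasDerivAt_supMin (hf : IsUnimodal f a b c d) (hg : IsUnimodal g a' b' c' d')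
    {y z k l r : ℝ} (hy : y < c) (hz : z < c') (h : f y = g z) (hkl : k + l = 1)
    (hfd : HasDerivAt (fun t => f (y + k * (t - (y + z)))) r (y + z))
    (hgd : HasDerivAt (fun t => g (z + l * (t - (y + z)))) r (y + z)) :
    HasDerivAt (supMin f g) r (y + z) := by
  have heq := hf.supMin_eq hg hy.le hz.le h
  have hsum : ∀ t, y + k * (t - (y + z)) + (z + l * (t - (y + z))) = t := fun t => by
    linear_combination (t - (y + z)) * hkl
  have hlt : ∀ {v m e : ℝ}, v < e → ∀ᶠ t in 𝓝 (y + z), v + m * (t - (y + z)) < e := by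
    intro v m e hv
    have hc : Continuous fun t : ℝ => v + m * (t - (y + z)) := by fun_prop
    exact hc.continuousAt.eventually_lt continuousAt_const (by simpa using hv)
  rw [← hasDerivWithinAt_univ] at hfd hgd ⊢
  refine hasDerivWithinAt_of_min_le_of_le_max hfd hgd (by simp [heq]) (by simp [heq, h]) ?_ ?_
  · refine .of_forall fun t => ?_
    have := hf.min_le_supMin (g := g) (y + k * (t - (y + z))) (z + l * (t - (y + z)))
    rwa [hsum] at this
  · rw [nhdsWithin_univ]
    filter_upwards [hlt (m := k) hy, hlt (m := l) hz] with t h1 h2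
    have := hf.supMin_le_max hg h1.le h2.le
    rwa [hsum] at this

lemma hasDerivAt_supMin_zero (hf : IsUnimodal f a b c d) (hg : IsUnimodal g a' b' c' d')
    {y z : ℝ} (hy : y < c) (hz : z < c') (h : f y = g z) (hfd : HasDerivAt f 0 y) :
    HasDerivAt (supMin f g) 0 (y + z) := by
  refine hf.hasDerivAt_supMin hg hy hz h (add_zero 1) ?_ ?_
  · have : HasDerivAt (fun t => y + 1 * (t - (y + z))) 1 (y + z) := by
      simpa using ((hasDerivAt_id (y + z)).sub_const (y + z)).const_add y
    have hfd' : HasDerivAt f 0 (y + 1 * (y + z - (y + z))) := by simpa using hfd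
    simpa [Function.comp_def] using hfd'.comp (y + z) this
  · simpa using hasDerivAt_const (y + z) (g z)

lemma differentiableAt_supMin_of_differentiableAt (hf : IsUnimodal f a b c d)
    (hg : IsUnimodal g a' b' c' d') {y z : ℝ} (hy : y < c) (hz : z < c') (h : f y = g z)
    (hfd : DifferentiableAt ℝ f y) (hgd : DifferentiableAt ℝ g z) :
    DifferentiableAt ℝ (supMin f g) (y + z) := by
  have key : ∀ {F : ℝ → ℝ} {v m p : ℝ}, HasDerivAt F p v →
      HasDerivAt (fun t => F (v + m * (t - (y + z)))) (p * m) (y + z) := by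
    intro F v m p hF
    have : HasDerivAt (fun t => v + m * (t - (y + z))) m (y + z) := by
      simpa using (((hasDerivAt_id (y + z)).sub_const (y + z)).const_mul m).const_add v
    have hF' : HasDerivAt F p (v + m * (y + z - (y + z))) := by simpa using hF
    exact hF'.comp (y + z) this
  have nonneg : ∀ {F : ℝ → ℝ} {v e : ℝ}, v < e → MonotoneOn F (Iic e) →
      DifferentiableAt ℝ F v → 0 ≤ deriv F v := by
    intro F v e hv hF hd
    rw [← hd.derivWithin (uniqueDiffOn_Iic e v hv.le)]
    exact hF.derivWithin_nonneg
  have hp := nonneg hy hf.mono hfd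
  have hq := nonneg hz hg.mono hgd
  by_cases h0 : deriv f y + deriv g z = 0
  · have : HasDerivAt f 0 y := by
      have := hfd.hasDerivAt
      rwa [show deriv f y = 0 by linarith] at this
    exact (hf.hasDerivAt_supMin_zero hg hy hz h this).differentiableAt
  · refine (hf.hasDerivAt_supMin hg hy hz h
      (k := deriv g z / (deriv f y + deriv g z)) (l := deriv f y / (deriv f y + deriv g z))
      (by field_simp; ring) (key hfd.hasDerivAt) ?_).differentiableAt
    convert key hgd.hasDerivAt using 1
    ring

/-- On the increasing branch, a differentiability point at which `f` still has its initial
value is a critical point. -/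
lemma hasDerivAt_zero_of_eq_left (hf : IsUnimodal f a b c d) {y : ℝ} (hay : a < y) (hyc : y ≤ c)
    (h : f y = f a) (hfd : DifferentiableAt ℝ f y) : HasDerivAt f 0 y := by
  have hc : HasDerivWithinAt f 0 (Icc a y) y := by
    refine (hasDerivWithinAt_const y (Icc a y) (f a)).congr (fun t ht => ?_) h
    refine le_antisymm ?_ (hf.mono (hay.le.trans hyc) (ht.2.trans hyc) ht.1)
    exact (hf.mono (ht.2.trans hyc) hyc ht.2).trans h.le
  have := (uniqueDiffOn_Icc hay y ⟨hay.le, le_rfl⟩).eq_deriv _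
    hfd.hasDerivAt.hasDerivWithinAt hc
  rw [← this]
  exact hfd.hasDerivAt

lemma exists_eq_of_mem (hf : IsUnimodal f a b c d) (hg : IsUnimodal g a' b' c' d')
    (h0 : g a' = f a) {x : ℝ} (hx : x ∈ Icc (a + a') (b + b')) :
    ∃ y ∈ Icc a b, ∃ z ∈ Icc a' b', y + z = x ∧ f y = g z := by
  obtain ⟨hx1, hx2⟩ := hx
  have hab := hf.ab
  have hab' := hg.ab
  have hle : max a (x - b') ≤ min b (x - a') :=
    max_le (le_min hab (by linarith)) (le_min (by linarith) (by linarith))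
  have hmem : ∀ y ∈ Icc (max a (x - b')) (min b (x - a')), y ∈ Icc a b ∧ x - y ∈ Icc a' b' := by
    rintro y ⟨h1, h2⟩
    rw [max_le_iff] at h1
    rw [le_min_iff] at h2
    exact ⟨⟨h1.1, h2.1⟩, by linarith, by linarith⟩
  have hfc : ContinuousOn f (Icc (max a (x - b')) (min b (x - a'))) :=
    hf.cont.mono fun y hy => ⟨(hmem y hy).1.1, (hmem y hy).1.2.trans (hf.bc.trans hf.cd)⟩
  have hgc : ContinuousOn (fun y => g (x - y)) (Icc (max a (x - b')) (min b (x - a'))) :=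
    hg.cont.comp (by fun_prop)
      fun y hy => ⟨(hmem y hy).2.1, (hmem y hy).2.2.trans (hg.bc.trans hg.cd)⟩
  have hl := hmem _ (left_mem_Icc.2 hle)
  have hr := hmem _ (right_mem_Icc.2 hle)
  obtain ⟨y, hy, hyeq⟩ := intermediate_value_Icc hle (hfc.sub hgc) (show (0 : ℝ) ∈ _ by
    constructor
    · simp only [Pi.sub_apply, sub_nonpos]
      rcases max_cases a (x - b') with h | h
      · rw [h.1] at hl ⊢
        rw [← h0]
        exact hg.mono (hg.ab.trans hg.bc) (hl.2.2.trans hg.bc) hl.2.1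
      · rw [h.1, sub_sub_cancel, hg.eq_one b' ⟨le_rfl, hg.bc⟩]
        exact hf.le_one _
    · simp only [Pi.sub_apply, sub_nonneg]
      rcases min_cases b (x - a') with h | h
      · rw [h.1, hf.eq_one b ⟨le_rfl, hf.bc⟩]
        exact hg.le_one _
      · rw [h.1] at hr ⊢
        rw [sub_sub_cancel, h0]
        exact hf.mono (hf.ab.trans hf.bc) (hr.1.2.trans hf.bc) hr.1.1)
  exact ⟨y, (hmem y hy).1, x - y, (hmem y hy).2, by ring, sub_eq_zero.1 hyeq⟩

lemma differentiableAt_supMin_of_lt (hf : IsUnimodal f a b c d) (hg : IsUnimodal g a' b' c' d')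
    (h0 : g a' = f a) (hfd : ∀ x ∈ Ioo a b, DifferentiableAt ℝ f x)
    (hgd : ∀ x ∈ Ioo a' b', DifferentiableAt ℝ g x)
    {x : ℝ} (hx : x ∈ Ioo (a + a') (b + b')) : DifferentiableAt ℝ (supMin f g) x := by
  obtain ⟨y, hy, z, hz, rfl, h⟩ := hf.exists_eq_of_mem hg h0 (Ioo_subset_Icc_self hx)
  obtain ⟨hx1, hx2⟩ := hx
  have hyb : y < b := by
    refine lt_of_le_of_ne hy.2 ?_
    rintro rfl
    rw [hf.eq_one y ⟨le_rfl, hf.bc⟩] at h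
    exact (hg.lt_one z fun hz' => by linarith [hz'.1]).ne h.symm
  have hzb : z < b' := by
    refine lt_of_le_of_ne hz.2 ?_
    rintro rfl
    rw [hg.eq_one z ⟨le_rfl, hg.bc⟩] at h
    exact (hf.lt_one y fun hy' => by linarith [hy'.1]).ne h
  have hyc := hyb.trans_le hf.bc
  have hzc := hzb.trans_le hg.bc
  rcases hy.1.eq_or_lt with rfl | hay
  · have haz : a' < z := by linarith
    rw [supMin_comm, add_comm]
    exact (hg.hasDerivAt_supMin_zero hf hzc hyc h.symm (hg.hasDerivAt_zero_of_eq_left haz hzc.le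
      (h.symm.trans h0.symm) (hgd z ⟨haz, hzb⟩))).differentiableAt
  rcases hz.1.eq_or_lt with rfl | haz
  · exact (hf.hasDerivAt_supMin_zero hg hyc hzc h (hf.hasDerivAt_zero_of_eq_left hay hyc.le
      (h.trans h0) (hfd y ⟨hay, hyb⟩))).differentiableAt
  exact hf.differentiableAt_supMin_of_differentiableAt hg hyc hzc h (hfd y ⟨hay, hyb⟩)
    (hgd z ⟨haz, hzb⟩)

lemma hasDerivWithinAt_supMin_peak (hf : IsUnimodal f a b c d) (hg : IsUnimodal g a' b' c' d')
    (hd : HasDerivWithinAt f 0 (Iic b) b) :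
    HasDerivWithinAt (supMin f g) 0 (Iic (b + b')) (b + b') := by
  have hfb := hf.eq_one b ⟨le_rfl, hf.bc⟩
  have hgb := hg.eq_one b' ⟨le_rfl, hg.bc⟩
  have hone : supMin f g (b + b') = 1 :=
    hf.supMin_eq_one hg ⟨le_rfl, add_le_add hf.bc hg.bc⟩
  have hf' : HasDerivWithinAt (fun t => f (t - b')) 0 (Iic (b + b')) (b + b') := by
    have hd' : HasDerivWithinAt f 0 (Iic b) (b + b' - b') := by simpa using hd
    have := hd'.comp (b + b') ((hasDerivWithinAt_id (b + b') (Iic (b + b'))).sub_const b')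
      fun t ht => by simpa using ht
    simpa [Function.comp_def] using this
  refine hasDerivWithinAt_of_min_le_of_le_max hf'
    (hasDerivWithinAt_const (b + b') (Iic (b + b')) (1 : ℝ)) (by simp [hfb, hone]) hone.symm
    (.of_forall fun t => ?_) (.of_forall fun t => ?_)
  · simpa [hgb] using hf.min_le_supMin (g := g) (t - b') b'
  · exact (hf.supMin_le_one t).trans (le_max_right _ _)

lemma hasDerivWithinAt_supMin_core (hf : IsUnimodal f a b c d) (hg : IsUnimodal g a' b' c' d')
    {x : ℝ} (hd : x = b + b' → HasDerivWithinAt f 0 (Iic b) b ∨ HasDerivWithinAt g 0 (Iic b') b')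
    (hx : x ∈ Icc (b + b') (c + c')) :
    HasDerivWithinAt (supMin f g) 0 (Iic x) x := by
  rcases hx.1.eq_or_lt with rfl | hlt
  · rcases hd rfl with hd | hd
    · exact hf.hasDerivWithinAt_supMin_peak hg hd
    · rw [supMin_comm, add_comm]
      exact hg.hasDerivWithinAt_supMin_peak hf hd
  · refine (hasDerivWithinAt_const x (Iic x) (1 : ℝ)).congr_of_eventuallyEq ?_
      (hf.supMin_eq_one hg hx)
    filter_upwards [self_mem_nhdsWithin, nhdsWithin_le_nhds (lt_mem_nhds hlt)] with t h1 h2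
    exact hf.supMin_eq_one hg ⟨h2.le, h1.trans hx.2⟩

lemma continuousWithinAt_supMin_left (hf : IsUnimodal f a b c d) (hg : IsUnimodal g a' b' c' d')
    (h0 : g a' = f a) :
    ContinuousWithinAt (supMin f g) (Icc (a + a') (d + d')) (a + a') := by
  have had : a ≤ d := hf.ab.trans (hf.bc.trans hf.cd)
  have had' : a' ≤ d' := hg.ab.trans (hg.bc.trans hg.cd)
  set k := (d - a) / (d + d' - (a + a'))
  set S := Icc (a + a') (d + d')
  have hS : a + a' ∈ S := ⟨le_rfl, by linarith⟩
  have hk0 : 0 ≤ k := div_nonneg (by linarith) (by linarith)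
  have hk1 : k ≤ 1 := div_le_one_of_le₀ (by linarith) (by linarith)
  have hmul : k * (d + d' - (a + a')) = d - a := by
    by_cases h : d + d' - (a + a') = 0
    · rw [h]; linarith
    · exact div_mul_cancel₀ _ h
  have hmem : ∀ t ∈ S, a + k * (t - (a + a')) ∈ Icc a d := by
    rintro t ⟨h1, h2⟩
    constructor
    · nlinarith
    · nlinarith
  have hmem' : ∀ t ∈ S, a' + (1 - k) * (t - (a + a')) ∈ Icc a' d' := by
    rintro t ⟨h1, h2⟩
    constructor
    · nlinarith
    · nlinarith
  have hF : ContinuousWithinAt (fun t => f (a + k * (t - (a + a')))) S (a + a') :=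
    (hf.cont.comp (by fun_prop) hmem) _ hS
  have hG : ContinuousWithinAt (fun t => g (a' + (1 - k) * (t - (a + a')))) S (a + a') :=
    (hg.cont.comp (by fun_prop) hmem') _ hS
  have hsum : ∀ t, a + k * (t - (a + a')) + (a' + (1 - k) * (t - (a + a'))) = t :=
    fun t => by ring
  have heq := hf.supMin_eq hg (hf.ab.trans hf.bc) (hg.ab.trans hg.bc) h0.symm
  have hmin : ∀ t, min (f (a + k * (t - (a + a')))) (g (a' + (1 - k) * (t - (a + a'))))
      ≤ supMin f g t := fun t => by
    have := hf.min_le_supMin (g := g) (a + k * (t - (a + a'))) (a' + (1 - k) * (t - (a + a')))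
    rwa [hsum] at this
  have hlow : Tendsto (fun t => min (f (a + k * (t - (a + a'))))
      (g (a' + (1 - k) * (t - (a + a'))))) (𝓝[S] (a + a')) (𝓝 (f a)) := by
    simpa [ContinuousWithinAt, h0] using hF.min hG
  have hup : Tendsto (fun t => max (f (a + k * (t - (a + a'))))
      (g (a' + (1 - k) * (t - (a + a'))))) (𝓝[S] (a + a')) (𝓝 (f a)) := by
    simpa [ContinuousWithinAt, h0] using hF.max hG
  rw [ContinuousWithinAt, heq]
  by_cases h1 : f a = 1
  · refine tendsto_of_tendsto_of_tendsto_of_le_of_le hlow tendsto_const_nhds hmin fun t => ?_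
    rw [h1]
    exact hf.supMin_le_one t
  · have hac : a < c := (lt_of_le_of_ne hf.ab (mt hf.left_eq_one_iff.2 h1)).trans_le hf.bc
    have hac' : a' < c' :=
      (lt_of_le_of_ne hg.ab (mt hg.left_eq_one_iff.2 (h0 ▸ h1))).trans_le hg.bc
    refine tendsto_of_tendsto_of_tendsto_of_le_of_le' hlow hup (.of_forall hmin) ?_
    have hlt : ∀ {v m e : ℝ}, v < e → ∀ᶠ t in 𝓝[S] (a + a'), v + m * (t - (a + a')) < e := by
      intro v m e hv
      have hc : Continuous fun t : ℝ => v + m * (t - (a + a')) := by fun_prop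
      exact nhdsWithin_le_nhds
        (hc.continuousAt.eventually_lt continuousAt_const (by simpa using hv))
    filter_upwards [hlt (m := k) hac, hlt (m := 1 - k) hac'] with t h2 h3
    have := hf.supMin_le_max hg h2.le h3.le
    rwa [hsum] at this

/-- At the left end of the plateau of the convolution, one of the two functions has a vanishing
left derivative. -/
lemma hasDerivWithinAt_zero_or (hf : IsUnimodal f a b c d) (hg : IsUnimodal g a' b' c' d')
    (h0 : g a' = f a)
    (hgd : ∀ x ∈ Ioo a' d', DifferentiableAt ℝ g x)
    (hpeak : b ∈ Ioo a d → ¬ DifferentiableAt ℝ f b → HasDerivWithinAt g 0 (Iio b') b')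
    (hab : a + a' < b + b') (hbd : b + b' < d + d') :
    HasDerivWithinAt f 0 (Iic b) b ∨ HasDerivWithinAt g 0 (Iic b') b' := by
  have crit : ∀ {F : ℝ → ℝ} {p q r s : ℝ}, IsUnimodal F p q r s → DifferentiableAt ℝ F q →
      HasDerivWithinAt F 0 (Iic q) q := by
    intro F p q r s hF hd
    have hmax : IsLocalMax F q := .of_forall fun t => by
      rw [hF.eq_one q ⟨le_rfl, hF.bc⟩]
      exact hF.le_one t
    have := hd.hasDerivAt
    rw [hmax.deriv_eq_zero] at this
    exact this.hasDerivWithinAt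
  have hiff : a' = b' ↔ a = b := by rw [← hg.left_eq_one_iff, h0, hf.left_eq_one_iff]
  have hne : a ≠ b := fun h => by linarith [hiff.2 h]
  have ha : a < b := lt_of_le_of_ne hf.ab hne
  have ha' : a' < b' := lt_of_le_of_ne hg.ab (mt hiff.1 hne)
  rcases (hg.bc.trans hg.cd).eq_or_lt with h | h
  · have hd : b < d := by linarith
    by_cases hfb : DifferentiableAt ℝ f b
    · exact .inl (crit hf hfb)
    · exact .inr (hpeak ⟨ha, hd⟩ hfb).Iic_of_Iio
  · exact .inr (crit hg (hgd b' ⟨ha', h⟩))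

/-- The sup-min convolution of unimodal functions is differentiable inside the sum of their
intervals, when `g` is and `f` is differentiable except possibly on its plateau, and
`g` is flat at the ends of its plateau wherever `f` is not differentiable. -/
lemma continuousOn_and_differentiableAt_supMin (hf : IsUnimodal f a b c d)
    (hg : IsUnimodal g a' b' c' d') (h0 : g a' = f a) (h1 : g d' = f d)
    (hfd : ∀ x ∈ Ioo a b ∪ Ioo c d, DifferentiableAt ℝ f x)
    (hgd : ∀ x ∈ Ioo a' d', DifferentiableAt ℝ g x)
    (hleft : b ∈ Ioo a d → ¬ DifferentiableAt ℝ f b → HasDerivWithinAt g 0 (Iio b') b')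
    (hright : c ∈ Ioo a d → ¬ DifferentiableAt ℝ f c → HasDerivWithinAt g 0 (Ioi c') c') :
    ContinuousOn (supMin f g) (Icc (a + a') (d + d')) ∧
      ∀ x ∈ Ioo (a + a') (d + d'), DifferentiableAt ℝ (supMin f g) x := by
  have hF := hf.comp_neg
  have hG := hg.comp_neg
  have hneg : supMin f g = fun x => supMin (fun t => f (-t)) (fun t => g (-t)) (-x) := by
    funext x
    rw [supMin_comp_neg, neg_neg]
  have hdiff_neg : ∀ {φ : ℝ → ℝ} {x : ℝ}, DifferentiableAt ℝ φ (-x) →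
      DifferentiableAt ℝ (fun t => φ (-t)) x := fun h => h.comp _ differentiableAt_id.neg
  have hG' : ∀ x ∈ Ioo (-d') (-a'), DifferentiableAt ℝ (fun t => g (-t)) x :=
    fun x hx => hdiff_neg (hgd _ ⟨lt_neg.1 hx.2, neg_lt.1 hx.1⟩)
  have hdiff : ∀ x ∈ Ioo (a + a') (d + d'), DifferentiableAt ℝ (supMin f g) x := by
    intro x hx
    rcases lt_or_ge x (b + b') with hxb | hxb
    · exact hf.differentiableAt_supMin_of_lt hg h0 (fun t ht => hfd t (.inl ht))
        (fun t ht => hgd t ⟨ht.1, ht.2.trans_le (hg.bc.trans hg.cd)⟩) ⟨hx.1, hxb⟩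
    rcases lt_or_ge (c + c') x with hxc | hxc
    · rw [hneg]
      refine hdiff_neg (hF.differentiableAt_supMin_of_lt hG (by simpa using h1)
        (fun t ht => hdiff_neg (hfd _ (.inr ⟨lt_neg.1 ht.2, neg_lt.1 ht.1⟩)))
        (fun t ht => hG' t ⟨ht.1, ht.2.trans_le (neg_le_neg (hg.ab.trans hg.bc))⟩)
        ⟨?_, ?_⟩) <;> linarith [hx.2]
    have hL : HasDerivWithinAt (supMin f g) 0 (Iic x) x :=
      hf.hasDerivWithinAt_supMin_core hg (fun h => hf.hasDerivWithinAt_zero_or hg h0 hgd hleft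
        (by linarith [hx.1]) (by linarith [hx.2])) ⟨hxb, hxc⟩
    have hR : HasDerivWithinAt (supMin f g) 0 (Ici x) x := by
      have := hF.hasDerivWithinAt_supMin_core hG (x := -x)
        (fun h => hF.hasDerivWithinAt_zero_or hG (by simpa using h1) hG'
          (fun hc hnd => ?_) (by linarith [hx.2]) (by linarith [hx.1]))
        ⟨by linarith, by linarith⟩
      · have h' := this.comp x (hasDerivWithinAt_neg x (Ici x)) fun t ht =>
          mem_Iic.2 (neg_le_neg (mem_Ici.1 ht))
        rw [hneg]
        simpa [Function.comp_def] using h'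
      · have hcd : c ∈ Ioo a d := ⟨neg_lt_neg_iff.1 hc.2, neg_lt_neg_iff.1 hc.1⟩
        have hr := hright hcd fun hd => hnd (hdiff_neg (by simpa using hd))
        rw [← neg_neg c'] at hr
        have h' := hr.comp (-c') (hasDerivWithinAt_neg (-c') (Iio (-c')))
          fun t ht => mem_Ioi.2 (neg_lt_neg (mem_Iio.1 ht))
        simpa [Function.comp_def] using h'
    have := hL.union hR
    rw [Iic_union_Ici, hasDerivWithinAt_univ] at this
    exact this.differentiableAt
  refine ⟨fun x hx => ?_, hdiff⟩
  rcases hx.1.eq_or_lt with rfl | hl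
  · exact hf.continuousWithinAt_supMin_left hg h0
  rcases hx.2.eq_or_lt with rfl | hr
  · have := hF.continuousWithinAt_supMin_left hG (by simpa using h1)
    rw [hneg]
    rw [← neg_add] at this
    refine this.comp continuous_neg.continuousWithinAt fun t ht => ⟨neg_le_neg ht.2, ?_⟩
    linarith [ht.1]
  exact (hdiff x ⟨hl, hr⟩).continuousAt.continuousWithinAt

end IsUnimodal

namespace FuzzyNumber

lemma isUnimodal (u : FuzzyNumber) (hu : ContinuousOn u.f (Icc (u.lo 0) (u.hi 0))) :
    IsUnimodal u.f (u.lo 0) (u.lo 1) (u.hi 1) (u.hi 0) := by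
  obtain ⟨b, c, hbc, h1⟩ := u.cut_isIcc 1 ⟨one_pos, le_rfl⟩
  obtain ⟨a, d, had, h0⟩ := u.supp_isIcc
  have hlo0 : u.lo 0 = a := by simp [lo, cut, h0, csInf_Icc had]
  have hhi0 : u.hi 0 = d := by simp [hi, cut, h0, csSup_Icc had]
  have hlo1 : u.lo 1 = b := by simp [lo, cut, h1, csInf_Icc hbc]
  have hhi1 : u.hi 1 = c := by simp [hi, cut, h1, csSup_Icc hbc]
  rw [hlo0, hhi0] at hu
  rw [hlo0, hhi0, hlo1, hhi1]
  have hmem : ∀ x, 1 ≤ u.f x ↔ x ∈ Icc b c := fun x => Set.ext_iff.1 h1 x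
  have hsub : Icc b c ⊆ Icc a d := by
    rw [← h1, ← h0]
    exact fun x (hx : 1 ≤ u.f x) => subset_closure (show 0 < u.f x from one_pos.trans_le hx)
  have hconv : ∀ x y z, x ≤ y → y ≤ z → min (u.f x) (u.f z) ≤ u.f y := by
    intro x y z hxy hyz
    rcases (le_min (u.mem_Icc x).1 (u.mem_Icc z).1).eq_or_lt with h | h
    · rw [← h]
      exact (u.mem_Icc y).1
    · obtain ⟨p, q, -, hpq⟩ :=
        u.cut_isIcc _ ⟨h, (min_le_left _ _).trans (u.mem_Icc x).2⟩
      have hx : x ∈ Icc p q := hpq ▸ min_le_left (u.f x) (u.f z)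
      have hz : z ∈ Icc p q := hpq ▸ min_le_right (u.f x) (u.f z)
      have hy : y ∈ Icc p q := ⟨hx.1.trans hxy, hyz.trans hz.2⟩
      rw [← hpq] at hy
      exact hy
  exact
    { ab := (hsub ⟨le_rfl, hbc⟩).1
      bc := hbc
      cd := (hsub ⟨hbc, le_rfl⟩).2
      mono := fun x _ y hy hxy => by
        have hc : u.f x ≤ u.f c := (u.mem_Icc x).2.trans ((hmem c).2 ⟨hbc, le_rfl⟩)
        simpa [hc] using hconv x y c hxy hy
      anti := fun x hx y _ hxy => by
        have hb : u.f y ≤ u.f b := (u.mem_Icc y).2.trans ((hmem b).2 ⟨le_rfl, hbc⟩)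
        simpa [hb] using hconv b x y hx hxy
      eq_one := fun x hx => le_antisymm (u.mem_Icc x).2 ((hmem x).2 hx)
      lt_one := fun x hx => lt_of_not_ge fun h => hx ((hmem x).1 h)
      cont := hu }

end FuzzyNumber

/-- Theorem `rap`: if `u ∈ F_N(ℝ) ∩ F_C(ℝ)`, `w ∈ F_D(ℝ)` and
`w` satisfies conditions (i), (ii-1), (ii-2), then `u∇w ∈ F_D(ℝ)`. -/
theorem conv_memFD_of_memFN_memFC (u w : FuzzyNumber)
    -- `u ∈ F_C(ℝ)`
    (huC : ContinuousOn u.f (Set.Icc (u.lo 0) (u.hi 0)))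
    -- `u ∈ F_N(ℝ)`
    (huN : ∀ x ∈ Set.Ioo (u.lo 0) (u.lo 1) ∪ Set.Ioo (u.hi 1) (u.hi 0),
      DifferentiableAt ℝ u.f x)
    -- `w ∈ F_D(ℝ)`
    (hwC : ContinuousOn w.f (Set.Icc (w.lo 0) (w.hi 0)))
    (hwD : ∀ x ∈ Set.Ioo (w.lo 0) (w.hi 0), DifferentiableAt ℝ w.f x)
    -- condition (i)
    (h1l : w.f (w.lo 0) = u.f (u.lo 0)) (h1r : w.f (w.hi 0) = u.f (u.hi 0))
    -- condition (ii-1)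
    (h21 : u.lo 1 ∈ Set.Ioo (u.lo 0) (u.hi 0) → ¬ DifferentiableAt ℝ u.f (u.lo 1) →
      HasLeftDerivAt w.f 0 (w.lo 1))
    -- condition (ii-2)
    (h22 : u.hi 1 ∈ Set.Ioo (u.lo 0) (u.hi 0) → ¬ DifferentiableAt ℝ u.f (u.hi 1) →
      HasRightDerivAt w.f 0 (w.hi 1)) :
    -- conclusion: `u∇w ∈ F_D(ℝ)`
    ContinuousOn (u.conv w) (Set.Icc (u.lo 0 + w.lo 0) (u.hi 0 + w.hi 0)) ∧
    ∀ x ∈ Set.Ioo (u.lo 0 + w.lo 0) (u.hi 0 + w.hi 0),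
      DifferentiableAt ℝ (u.conv w) x := by
  exact (u.isUnimodal huC).continuousOn_and_differentiableAt_supMin (w.isUnimodal hwC)
    h1l h1r huN hwD h21 h22
end
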